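/- arXiv:2403.06626 — 3 statements merged into one kernel-verified Lean document; each statement's English description precedes it below -/
import Mathlib

section
/- For every nonzero c ∈ ℤ[i] and every n ∈ ℤ[i], ρ_c(n² − 4) = N(c)^{−1}·Σ_{h ∈ ℤ[i]/(c)} e(Re(h̃·n/c))·S(h̃, h̃, c), where h̃ ∈ ℤ[i] is any lift of the residue class h (both factors in the summand are independent of the choice of lift, since S(m, n, c) depends only on m and n modulo c). -/
noncomputable section

namespace PGT

def Gnorm (n : GaussianInt) : ℕ := (Zsqrtd.norm n).natAbs

def Gphi (c : GaussianInt) : ℕ :=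
  Nat.card (GaussianInt ⧸ Ideal.span ({c} : Set GaussianInt))ˣ

def rhoc (c δ : GaussianInt) : ℕ :=
  Nat.card {x : GaussianInt ⧸ Ideal.span ({2 * c} : Set GaussianInt) //
    ∃ y : GaussianInt, Ideal.Quotient.mk (Ideal.span ({2 * c} : Set GaussianInt)) y = x ∧
      4 * c ∣ y ^ 2 - δ}

def rhoG (c a : GaussianInt) : ℕ :=
  Nat.card {d : GaussianInt ⧸ Ideal.span ({c} : Set GaussianInt) //
    d ^ 2 - (Ideal.Quotient.mk (Ideal.span ({c} : Set GaussianInt)) a) * d + 1 = 0}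

def NStar (c : GaussianInt) : ℕ :=
  sSup {m : ℕ | ∃ d : GaussianInt, d ^ 2 ∣ c ∧ m = Gnorm d}

open Classical in
def muG (c : GaussianInt) : ℤ :=
  if Squarefree c then (-1) ^ (UniqueFactorizationMonoid.factors c).card else 0

def genG (I : Ideal GaussianInt) : GaussianInt := Submodule.IsPrincipal.generator I

def lamc (c δ : GaussianInt) : ℤ :=
  ∑ᶠ t ∈ {t : Ideal GaussianInt × Ideal GaussianInt × Ideal GaussianInt |
      t.1 ^ 2 * t.2.1 * t.2.2 = Ideal.span ({c} : Set GaussianInt)},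
    muG (genG t.2.1) * (rhoc (genG t.2.2) δ : ℤ)

open Classical in
def legG (p x : GaussianInt) : ℤ :=
  if p ∣ x then 0 else if ∃ y : GaussianInt, p ∣ y ^ 2 - x then 1 else -1

def quadSym (r x : GaussianInt) : ℤ :=
  ((UniqueFactorizationMonoid.factors r).map (fun p => legG p x)).prod

def muTilde (r : GaussianInt) : ℤ :=
  ∑ᶠ a : GaussianInt ⧸ Ideal.span ({r} : Set GaussianInt),
    quadSym r ((Quotient.out a) ^ 2 - 4)

def tauI (n : GaussianInt) : ℕ :=
  Nat.card {I : Ideal GaussianInt // I ∣ Ideal.span ({n} : Set GaussianInt)}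

def zetaQi : ℝ := (1 / 4) * ∑' n : {n : GaussianInt // n ≠ 0}, 1 / ((Gnorm n.1 : ℝ)) ^ 2

def eG (t : ℝ) : ℂ := Complex.exp (2 * Real.pi * Complex.I * t)

def kloost (m n c : GaussianInt) : ℂ :=
  ∑ᶠ a : (GaussianInt ⧸ Ideal.span ({c} : Set GaussianInt))ˣ,
    eG ((GaussianInt.toComplex
        (m * Quotient.out ((a : GaussianInt ⧸ Ideal.span ({c} : Set GaussianInt))) +
         n * Quotient.out (((a⁻¹ : (GaussianInt ⧸ Ideal.span ({c} : Set GaussianInt))ˣ) :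
            GaussianInt ⧸ Ideal.span ({c} : Set GaussianInt)))) /
      GaussianInt.toComplex c).re)

theorem exists_basis_leftMulMatrix_eq (c : GaussianInt) :
    ∃ b : Module.Basis (Fin 2) ℤ GaussianInt,
      Algebra.leftMulMatrix b c = !![c.re, -c.im; c.im, c.re] := by
  let e : GaussianInt ≃ₗ[ℤ] (Fin 2 → ℤ) :=
    { toFun := fun z => ![z.re, z.im]
      invFun := fun v => ⟨v 0, v 1⟩
      map_add' := fun x y => by ext i; fin_cases i <;> simp
      map_smul' := fun m x => by ext i; fin_cases i <;> simp
      left_inv := fun x => by ext <;> simp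
      right_inv := fun v => by ext i; fin_cases i <;> simp }
  have he : ∀ j, e.symm (Pi.single j 1) = ⟨(Pi.single j 1 : Fin 2 → ℤ) 0,
      (Pi.single j 1 : Fin 2 → ℤ) 1⟩ := fun j => rfl
  have he' : ∀ z, e z = ![z.re, z.im] := fun z => rfl
  refine ⟨Module.Basis.ofEquivFun e, ?_⟩
  ext i j
  rw [Algebra.leftMulMatrix_eq_repr_mul]
  fin_cases i <;> fin_cases j <;>
    simp [he, he', Module.Basis.ofEquivFun_repr_apply, Zsqrtd.re_mul, Zsqrtd.im_mul]

theorem card_quotient_span_singleton (c : GaussianInt) :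
    Nat.card (GaussianInt ⧸ Ideal.span ({c} : Set GaussianInt)) = Gnorm c := by
  obtain ⟨b, hb⟩ := exists_basis_leftMulMatrix_eq c
  have := Module.Free.of_basis b
  have := Module.Finite.of_basis b
  have h := Ideal.absNorm_span_singleton c
  rw [Algebra.norm_eq_matrix_det b, hb, Matrix.det_fin_two_of, Ideal.absNorm_apply,
    Submodule.cardQuot_apply] at h
  rw [Gnorm, h, Zsqrtd.norm_def]
  congr 1
  ring

theorem Gnorm_ne_zero {c : GaussianInt} (hc : c ≠ 0) : Gnorm c ≠ 0 := by
  simpa [Gnorm, GaussianInt.norm_eq_zero] using hc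

theorem finite_quotient_span_singleton {c : GaussianInt} (hc : c ≠ 0) :
    Finite (GaussianInt ⧸ Ideal.span ({c} : Set GaussianInt)) :=
  Nat.finite_of_card_ne_zero (card_quotient_span_singleton c ▸ Gnorm_ne_zero hc)

theorem eG_add (s t : ℝ) : eG (s + t) = eG s * eG t := by
  simp only [eG, ← Complex.exp_add]
  push_cast
  ring_nf

theorem eG_eq_one_iff (t : ℝ) : eG t = 1 ↔ ∃ k : ℤ, t = k := by
  rw [eG, Complex.exp_eq_one_iff]
  refine exists_congr fun k => ?_
  rw [mul_comm (k : ℂ), mul_right_inj' Complex.two_pi_I_ne_zero]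
  exact_mod_cast Iff.rfl

/-- The additive character `w ↦ e(Re(w / c))` of `ℤ[i]`. -/
def fracChar (c w : GaussianInt) : ℂ :=
  eG ((GaussianInt.toComplex w / GaussianInt.toComplex c).re)

theorem fracChar_add (c v w : GaussianInt) :
    fracChar c (v + w) = fracChar c v * fracChar c w := by
  rw [fracChar, map_add, add_div, Complex.add_re, eG_add, fracChar, fracChar]

theorem fracChar_eq_one_of_dvd {c w : GaussianInt} (hc : c ≠ 0) (h : c ∣ w) :
    fracChar c w = 1 := by
  obtain ⟨k, rfl⟩ := h
  have hc' : GaussianInt.toComplex c ≠ 0 := by simpa [GaussianInt.toComplex_eq_zero] using hc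
  rw [fracChar, map_mul, mul_div_cancel_left₀ _ hc', eG_eq_one_iff]
  exact ⟨k.re, (GaussianInt.intCast_re k).symm⟩

theorem fracChar_congr {c v w : GaussianInt} (hc : c ≠ 0) (h : c ∣ v - w) :
    fracChar c v = fracChar c w := by
  rw [← sub_add_cancel v w, fracChar_add, fracChar_eq_one_of_dvd hc h, one_mul]

theorem exists_fracChar_mul_ne_one {c w : GaussianInt} (hc : c ≠ 0) (h : ¬ c ∣ w) :
    ∃ g, fracChar c (g * w) ≠ 1 := by
  have hc' : GaussianInt.toComplex c ≠ 0 := by simpa [GaussianInt.toComplex_eq_zero] using hc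
  by_contra! H
  obtain ⟨k, hk⟩ := (eG_eq_one_iff _).1 (H 1)
  obtain ⟨l, hl⟩ := (eG_eq_one_iff _).1 (H ⟨0, -1⟩)
  refine h ⟨⟨k, l⟩, ?_⟩
  rw [← GaussianInt.toComplex_inj, map_mul, mul_comm, ← div_eq_iff hc']
  have hI : GaussianInt.toComplex ⟨0, -1⟩ = -Complex.I := by
    simp [GaussianInt.toComplex_def']
  rw [map_mul, hI, mul_div_assoc] at hl
  rw [one_mul] at hk
  apply Complex.ext
  · simpa [GaussianInt.toComplex_def'] using hk
  · simpa [GaussianInt.toComplex_def'] using hl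

theorem mk_out_sub_dvd (c g : GaussianInt) :
    c ∣ Quotient.out (Ideal.Quotient.mk (Ideal.span ({c} : Set GaussianInt)) g) - g := by
  rw [← Ideal.mem_span_singleton, ← Ideal.Quotient.eq]
  exact Quotient.out_eq _

open Classical in
theorem sum_fracChar_mul {c : GaussianInt} (hc : c ≠ 0)
    [Fintype (GaussianInt ⧸ Ideal.span ({c} : Set GaussianInt))] (w : GaussianInt) :
    ∑ h : GaussianInt ⧸ Ideal.span ({c} : Set GaussianInt), fracChar c (Quotient.out h * w) =
      if c ∣ w then (Gnorm c : ℂ) else 0 := by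
  split_ifs with hw
  · rw [Finset.sum_congr rfl fun h _ => fracChar_eq_one_of_dvd hc (hw.mul_left _)]
    simp [← card_quotient_span_singleton c, Nat.card_eq_fintype_card]
  · obtain ⟨g, hg⟩ := exists_fracChar_mul_ne_one hc hw
    have key := Equiv.sum_comp (Equiv.addRight (Ideal.Quotient.mk (Ideal.span {c}) g))
      fun h => fracChar c (Quotient.out h * w)
    have hshift : ∀ h : GaussianInt ⧸ Ideal.span ({c} : Set GaussianInt),
        fracChar c (Quotient.out (h + Ideal.Quotient.mk (Ideal.span {c}) g) * w) =
          fracChar c (Quotient.out h * w) * fracChar c (g * w) := by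
      intro h
      rw [← fracChar_add, ← add_mul]
      refine fracChar_congr hc ?_
      rw [← sub_mul]
      refine Dvd.dvd.mul_right ?_ _
      have h1 : Ideal.Quotient.mk (Ideal.span ({c} : Set GaussianInt)) (Quotient.out h) = h :=
        Quotient.out_eq h
      conv_rhs => rw [← h1, ← map_add, h1]
      exact mk_out_sub_dvd c _
    simp only [Equiv.coe_addRight, hshift, ← Finset.sum_mul] at key
    by_contra hne
    exact hg (mul_left_cancel₀ hne (key.trans (mul_one _).symm))

theorem two_dvd_sub_of_four_dvd_sq_sub_sq {y n : GaussianInt} (h : 4 ∣ y ^ 2 - n ^ 2) :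
    2 ∣ y - n := by
  have hdec : ∀ a b p q : ZMod 4, a * a - b * b = p * p - q * q → 2 * (a * b) = 2 * (p * q) →
      2 * (a - p) = 0 ∧ 2 * (b - q) = 0 := by decide
  have two : ∀ z : ℤ, 2 * ((z : ℤ) : ZMod 4) = 0 → (2 : ℤ) ∣ z := by
    intro z hz
    have := (ZMod.intCast_zmod_eq_zero_iff_dvd (2 * z) 4).1 (by push_cast; exact hz)
    push_cast at this
    lia
  obtain ⟨k, hk⟩ := h
  have hre := congrArg Zsqrtd.re hk
  have him := congrArg Zsqrtd.im hk
  have h4 : (4 : GaussianInt) = ⟨4, 0⟩ := rfl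
  rw [h4] at hre him
  simp only [pow_two, Zsqrtd.re_sub, Zsqrtd.im_sub, Zsqrtd.re_mul, Zsqrtd.im_mul] at hre him
  have hre' := congrArg (Int.cast : ℤ → ZMod 4) hre
  have him' := congrArg (Int.cast : ℤ → ZMod 4) him
  have h40 : (4 : ZMod 4) = 0 := rfl
  push_cast at hre' him'
  rw [h40] at hre' him'
  obtain ⟨h1, h2⟩ := hdec y.re y.im n.re n.im (by linear_combination hre')
    (by linear_combination him')
  obtain ⟨s, hs⟩ := two (y.re - n.re) (by push_cast; exact h1)
  obtain ⟨t, ht⟩ := two (y.im - n.im) (by push_cast; exact h2)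
  refine ⟨⟨s, t⟩, ?_⟩
  have h2' : (2 : GaussianInt) = ⟨2, 0⟩ := rfl
  rw [h2']
  ext <;> simp [Zsqrtd.re_mul, Zsqrtd.im_mul, hs, ht]

theorem dvd_out_mul_out_inv_sub_one (c : GaussianInt)
    (a : (GaussianInt ⧸ Ideal.span ({c} : Set GaussianInt))ˣ) :
    c ∣ Quotient.out (a : GaussianInt ⧸ Ideal.span ({c} : Set GaussianInt)) *
      Quotient.out ((a⁻¹ : (GaussianInt ⧸ Ideal.span ({c} : Set GaussianInt))ˣ) :
        GaussianInt ⧸ Ideal.span ({c} : Set GaussianInt)) - 1 := by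
  have mk_out : ∀ x : GaussianInt ⧸ Ideal.span ({c} : Set GaussianInt),
      Ideal.Quotient.mk (Ideal.span ({c} : Set GaussianInt)) (Quotient.out x) = x := Quotient.out_eq
  rw [← Ideal.mem_span_singleton, ← Ideal.Quotient.eq, map_mul, map_one, mk_out, mk_out,
    Units.mul_inv]

theorem rhoc_eq_card_units (c n : GaussianInt) :
    rhoc c (n ^ 2 - 4) =
      Nat.card {a : (GaussianInt ⧸ Ideal.span ({c} : Set GaussianInt))ˣ //
        c ∣ n + (Quotient.out (a : GaussianInt ⧸ Ideal.span ({c} : Set GaussianInt)) +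
          Quotient.out ((a⁻¹ : (GaussianInt ⧸ Ideal.span ({c} : Set GaussianInt))ˣ) :
            GaussianInt ⧸ Ideal.span ({c} : Set GaussianInt)))} := by
  have mk_out : ∀ x : GaussianInt ⧸ Ideal.span ({c} : Set GaussianInt),
      Ideal.Quotient.mk (Ideal.span ({c} : Set GaussianInt)) (Quotient.out x) = x := Quotient.out_eq
  have h2 : (2 : GaussianInt) ≠ 0 := by decide
  have h4 : (4 : GaussianInt) ≠ 0 := by decide
  symm
  refine Nat.card_congr (Equiv.ofBijective (fun a =>
    ⟨Ideal.Quotient.mk _ (2 * Quotient.out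
      (a.1 : GaussianInt ⧸ Ideal.span ({c} : Set GaussianInt)) + n), _, rfl, ?_⟩) ⟨?_, ?_⟩)
  · obtain ⟨a, ha⟩ := a
    obtain ⟨s, hs⟩ := ha
    obtain ⟨t, ht⟩ := dvd_out_mul_out_inv_sub_one c a
    refine ⟨Quotient.out (a : GaussianInt ⧸ Ideal.span ({c} : Set GaussianInt)) * s - t, ?_⟩
    linear_combination 4 * Quotient.out
      (a : GaussianInt ⧸ Ideal.span ({c} : Set GaussianInt)) * hs - 4 * ht
  · rintro ⟨a, ha⟩ ⟨b, hb⟩ hab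
    have h := congrArg Subtype.val hab
    rw [Ideal.Quotient.eq, Ideal.mem_span_singleton, add_sub_add_right_eq_sub, ← mul_sub,
      mul_dvd_mul_iff_left h2, ← Ideal.mem_span_singleton, ← Ideal.Quotient.eq, mk_out,
      mk_out] at h
    exact Subtype.ext (Units.ext h)
  · rintro ⟨_, y, rfl, hy⟩
    obtain ⟨d, hd⟩ : 2 ∣ y - n := by
      refine two_dvd_sub_of_four_dvd_sq_sub_sq ?_
      have := (dvd_of_mul_right_dvd hy).sub (dvd_refl 4)
      ring_nf at this ⊢
      exact this
    obtain rfl : y = 2 * d + n := by linear_combination hd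
    have hdn : c ∣ d * -(n + d) - 1 := by
      rw [← mul_dvd_mul_iff_left h4, ← dvd_neg]
      convert hy using 1
      ring
    have hmul : Ideal.Quotient.mk (Ideal.span ({c} : Set GaussianInt)) d *
        Ideal.Quotient.mk _ (-(n + d)) = 1 := by
      rwa [← map_mul, ← map_one (Ideal.Quotient.mk _), Ideal.Quotient.eq,
        Ideal.mem_span_singleton]
    refine ⟨⟨Units.mkOfMulEqOne _ _ hmul, ?_⟩, Subtype.ext ?_⟩
    · rw [← Ideal.mem_span_singleton, ← Ideal.Quotient.eq_zero_iff_mem, map_add, map_add, mk_out,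
        mk_out]
      change Ideal.Quotient.mk _ n + (Ideal.Quotient.mk _ d + Ideal.Quotient.mk _ (-(n + d))) = 0
      rw [← map_add, ← map_add]
      simp
    · change Ideal.Quotient.mk _ _ = Ideal.Quotient.mk _ _
      rw [Ideal.Quotient.eq, Ideal.mem_span_singleton, add_sub_add_right_eq_sub, ← mul_sub,
        mul_dvd_mul_iff_left h2]
      exact mk_out_sub_dvd c d

theorem stmt7 : ∀ c : GaussianInt, c ≠ 0 → ∀ n : GaussianInt,
    (rhoc c (n ^ 2 - 4) : ℂ) =
      (Gnorm c : ℂ)⁻¹ *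
        ∑ᶠ h : GaussianInt ⧸ Ideal.span ({c} : Set GaussianInt),
          eG ((GaussianInt.toComplex (Quotient.out h * n) / GaussianInt.toComplex c).re) *
            kloost (Quotient.out h) (Quotient.out h) c := by
  classical
  intro c hc n
  have := finite_quotient_span_singleton hc
  have := Fintype.ofFinite (GaussianInt ⧸ Ideal.span ({c} : Set GaussianInt))
  have hN : (Gnorm c : ℂ) ≠ 0 := Nat.cast_ne_zero.2 (Gnorm_ne_zero hc)
  have hterm : ∀ h : GaussianInt ⧸ Ideal.span ({c} : Set GaussianInt),
      eG ((GaussianInt.toComplex (Quotient.out h * n) / GaussianInt.toComplex c).re) *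
        kloost (Quotient.out h) (Quotient.out h) c =
      ∑ a : (GaussianInt ⧸ Ideal.span ({c} : Set GaussianInt))ˣ, fracChar c (Quotient.out h *
        (n + (Quotient.out (a : GaussianInt ⧸ Ideal.span ({c} : Set GaussianInt)) +
          Quotient.out ((a⁻¹ : (GaussianInt ⧸ Ideal.span ({c} : Set GaussianInt))ˣ) :
            GaussianInt ⧸ Ideal.span ({c} : Set GaussianInt))))) := by
    intro h
    rw [kloost, finsum_eq_sum_of_fintype, Finset.mul_sum]
    refine Finset.sum_congr rfl fun a _ => ?_
    rw [mul_add, fracChar_add, mul_add]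
    rfl
  rw [finsum_eq_sum_of_fintype, Finset.sum_congr rfl fun h _ => hterm h, Finset.sum_comm,
    Finset.sum_congr rfl fun a _ => sum_fracChar_mul hc _, ← Finset.sum_filter, Finset.sum_const,
    nsmul_eq_mul, mul_comm, mul_assoc, mul_inv_cancel₀ hN, mul_one, rhoc_eq_card_units,
    Nat.card_eq_fintype_card, Fintype.card_subtype]

end PGT
end
end

section
/- Let k ∈ ℤ[i] be nonzero, squarefree, with N(k) odd. Then for every a ∈ ℤ[i], ρ(k, a) = Σ_{r ∣ k} (a²−4 / r), where the sum runs over the divisors r of k taken up to associates, and the term for r a unit equals 1. -/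
noncomputable section

namespace PGT

theorem legG_congr {p q : GaussianInt} (h : Associated p q) (x : GaussianInt) :
    legG p x = legG q x := by
  classical
  simp only [legG, h.dvd_iff_dvd_left]

theorem quadSym_of_isUnit {r : GaussianInt} (hr : IsUnit r) (x : GaussianInt) :
    quadSym r x = 1 := by
  simp [quadSym, UniqueFactorizationMonoid.factors_of_isUnit hr]

theorem map_legG_prod_congr {s t : Multiset GaussianInt} (h : Multiset.Rel Associated s t)
    (x : GaussianInt) :
    (s.map fun p => legG p x).prod = (t.map fun p => legG p x).prod := by
  induction h with
  | zero => rfl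
  | cons hab _ ih => simp [legG_congr hab, ih]

theorem quadSym_congr {r s : GaussianInt} (h : Associated r s) (x : GaussianInt) :
    quadSym r x = quadSym s x := by
  rcases eq_or_ne r 0 with rfl | hr
  · rw [associated_zero_iff_eq_zero s |>.1 h.symm]
  · exact map_legG_prod_congr
      (UniqueFactorizationMonoid.factors_rel_of_associated h) x

theorem quadSym_mul {r s : GaussianInt} (hr : r ≠ 0) (hs : s ≠ 0) (x : GaussianInt) :
    quadSym (r * s) x = quadSym r x * quadSym s x := by
  rw [quadSym, map_legG_prod_congr (UniqueFactorizationMonoid.factors_mul hr hs),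
    Multiset.map_add, Multiset.prod_add]
  rfl

theorem quadSym_of_prime {p : GaussianInt} (hp : Prime p) (x : GaussianInt) :
    quadSym p x = legG p x := by
  obtain ⟨q, hpq, hq⟩ := prime_factors_irreducible hp.irreducible
    ⟨UniqueFactorizationMonoid.prime_of_factor, UniqueFactorizationMonoid.factors_prod hp.ne_zero⟩
  rw [quadSym, hq, Multiset.map_singleton, Multiset.prod_singleton, legG_congr hpq]

theorem associated_genG_span (r : GaussianInt) : Associated (genG (Ideal.span {r})) r :=
  Submodule.IsPrincipal.associated_generator_span_self r

theorem span_genG (I : Ideal GaussianInt) : Ideal.span {genG I} = I :=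
  Ideal.span_singleton_generator I

theorem quadSym_genG_mul {I J : Ideal GaussianInt} (hI : I ≠ ⊥) (hJ : J ≠ ⊥) (x : GaussianInt) :
    quadSym (genG (I * J)) x = quadSym (genG I) x * quadSym (genG J) x := by
  have h : Associated (genG (I * J)) (genG I * genG J) := by
    conv_lhs => rw [← span_genG I, ← span_genG J, Ideal.span_singleton_mul_span_singleton]
    exact associated_genG_span _
  have hne {K : Ideal GaussianInt} (hK : K ≠ ⊥) : genG K ≠ 0 := fun h0 =>
    hK (by rw [← span_genG K, h0, Ideal.span_singleton_eq_bot])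
  rw [quadSym_congr h, quadSym_mul (hne hI) (hne hJ)]

theorem setOf_dvd_prime_mul {P M : Ideal GaussianInt} (hP : Prime P) :
    {I | I ∣ P * M} = {I | I ∣ M} ∪ (P * ·) '' {I | I ∣ M} := by
  ext I
  simp only [Set.mem_ofPred_eq, Set.mem_union, Set.mem_image]
  constructor
  · intro h
    by_cases hPI : P ∣ I
    · obtain ⟨J, rfl⟩ := hPI
      exact Or.inr ⟨J, (mul_dvd_mul_iff_left hP.ne_zero).1 h, rfl⟩
    · obtain ⟨J, hJ⟩ := h
      obtain ⟨J, rfl⟩ := (hP.dvd_or_dvd (hJ ▸ dvd_mul_right P M)).resolve_left hPI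
      refine Or.inl ⟨J, mul_left_cancel₀ hP.ne_zero ?_⟩
      rw [hJ]; ring
  · rintro (h | ⟨J, h, rfl⟩)
    · exact h.mul_left P
    · exact mul_dvd_mul_left P h

theorem finite_setOf_dvd {I : Ideal GaussianInt} (hI : I ≠ ⊥) :
    {J : Ideal GaussianInt | J ∣ I}.Finite := by
  have := UniqueFactorizationMonoid.fintypeSubtypeDvd I hI
  rw [← Set.finite_coe_iff, Set.coe_ofPred]
  infer_instance

theorem finsum_quadSym_prime_mul {p m : GaussianInt} (hp : Prime p) (hm : m ≠ 0) (hpm : ¬ p ∣ m)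
    (x : GaussianInt) :
    ∑ᶠ I ∈ {I : Ideal GaussianInt | I ∣ Ideal.span {p * m}}, quadSym (genG I) x =
      (1 + legG p x) *
        ∑ᶠ I ∈ {I : Ideal GaussianInt | I ∣ Ideal.span {m}}, quadSym (genG I) x := by
  have hP : Prime (Ideal.span {p}) :=
    Ideal.prime_of_isPrime (by simpa using hp.ne_zero)
      ((Ideal.span_singleton_prime hp.ne_zero).2 hp)
  have hM : Ideal.span {m} ≠ ⊥ := by simpa using hm
  have hfin := finite_setOf_dvd hM
  have hdisj : Disjoint {I : Ideal GaussianInt | I ∣ Ideal.span {m}}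
      ((Ideal.span {p} * ·) '' {I | I ∣ Ideal.span {m}}) := by
    rw [Set.disjoint_right]
    rintro _ ⟨J, -, rfl⟩ h
    refine hpm ?_
    rw [← Ideal.span_singleton_le_span_singleton]
    exact Ideal.le_of_dvd ((dvd_mul_right _ _).trans h)
  rw [← Ideal.span_singleton_mul_span_singleton, setOf_dvd_prime_mul hP,
    finsum_mem_union hdisj hfin (hfin.image _),
    finsum_mem_image (mul_right_injective₀ hP.ne_zero).injOn, add_mul, one_mul,
    mul_finsum_mem]
  congr 1
  refine finsum_mem_congr rfl fun J hJ => ?_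
  have hJ0 : J ≠ ⊥ := ne_zero_of_dvd_ne_zero hM hJ
  rw [quadSym_genG_mul hP.ne_zero hJ0, quadSym_congr (associated_genG_span p),
    quadSym_of_prime hp]

theorem rhoG_mul {m n : GaussianInt} (h : IsCoprime m n) (a : GaussianInt) :
    rhoG (m * n) a = rhoG m a * rhoG n a := by
  have hI : IsCoprime (Ideal.span {m}) (Ideal.span {n}) :=
    (Ideal.isCoprime_span_singleton_iff m n).2 h
  unfold rhoG
  rw [← Nat.card_prod]
  let e := (Ideal.quotEquivOfEq (Ideal.span_singleton_mul_span_singleton m n).symm).trans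
    (Ideal.quotientMulEquivQuotientProd (Ideal.span {m}) (Ideal.span {n}) hI)
  refine Nat.card_congr ((e.toEquiv.subtypeEquiv fun d => ?_).trans
    (Equiv.subtypeProdEquivProd
      (p := fun d => d ^ 2 - Ideal.Quotient.mk (Ideal.span {m}) a * d + 1 = 0)
      (q := fun d => d ^ 2 - Ideal.Quotient.mk (Ideal.span {n}) a * d + 1 = 0)))
  have ha : e (Ideal.Quotient.mk _ a) = (Ideal.Quotient.mk _ a, Ideal.Quotient.mk _ a) := rfl
  rw [← map_eq_zero_iff e e.injective, map_add, map_sub, map_mul, map_pow, map_one, ha,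
    Prod.ext_iff]
  rfl

theorem rhoG_of_isUnit {u : GaussianInt} (hu : IsUnit u) (a : GaussianInt) : rhoG u a = 1 := by
  have : Subsingleton (GaussianInt ⧸ Ideal.span {u}) :=
    Ideal.Quotient.subsingleton_iff.2 (Ideal.span_singleton_eq_top.2 hu)
  rw [rhoG, Nat.card_eq_one_iff_unique]
  exact ⟨inferInstance, ⟨0, Subsingleton.elim _ _⟩⟩

open Classical in
theorem natCard_sq_eq {F : Type*} [Field F] (h2 : (2 : F) ≠ 0) (x : F) :
    (Nat.card {y : F // y ^ 2 = x} : ℤ) =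
      1 + if x = 0 then 0 else if ∃ y, y ^ 2 = x then 1 else -1 := by
  split_ifs with h0 h
  · subst h0
    simp
  · obtain ⟨y, rfl⟩ := h
    have hy : y ≠ -y := fun h => by
      have : 2 * y = 0 := by linear_combination h
      exact h0 (by rw [(mul_eq_zero.1 this).resolve_left h2, zero_pow two_ne_zero])
    have hset : {z : F | z ^ 2 = y ^ 2} = {y, -y} := by
      ext z
      simp [sq_eq_sq_iff_eq_or_eq_neg]
    change ((Nat.card {z : F | z ^ 2 = y ^ 2} : ℕ) : ℤ) = _
    rw [hset, Nat.card_coe_set_eq, Set.ncard_pair hy]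
    norm_num
  · have : IsEmpty {y : F // y ^ 2 = x} := ⟨fun y => h ⟨y, y.2⟩⟩
    simp

theorem natCard_quadratic_eq {F : Type*} [Field F] (h2 : (2 : F) ≠ 0) (a : F) :
    Nat.card {d : F // d ^ 2 - a * d + 1 = 0} = Nat.card {y : F // y ^ 2 = a ^ 2 - 4} := by
  refine Nat.card_congr
    (((Equiv.mulLeft₀ 2 h2).trans (Equiv.subRight a)).subtypeEquiv fun d => ?_)
  have h4 : (4 : F) ≠ 0 := by
    rw [show (4 : F) = 2 * 2 by norm_num]
    exact mul_ne_zero h2 h2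
  change _ ↔ (2 * d - a) ^ 2 = a ^ 2 - 4
  constructor
  · intro h
    linear_combination 4 * h
  · intro h
    apply mul_left_cancel₀ h4
    linear_combination h

theorem rhoG_of_prime {p : GaussianInt} (hp : Prime p) (h2 : ¬ p ∣ 2) (a : GaussianInt) :
    (rhoG p a : ℤ) = 1 + legG p (a ^ 2 - 4) := by
  classical
  have hmax : (Ideal.span {p}).IsMaximal :=
    PrincipalIdealRing.isMaximal_of_irreducible hp.irreducible
  let _ : Field (GaussianInt ⧸ Ideal.span {p}) := Ideal.Quotient.field _
  have hdvd (y : GaussianInt) : Ideal.Quotient.mk (Ideal.span {p}) y = 0 ↔ p ∣ y := by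
    rw [Ideal.Quotient.eq_zero_iff_mem, Ideal.mem_span_singleton]
  have h2' : (2 : GaussianInt ⧸ Ideal.span {p}) ≠ 0 := fun h =>
    h2 ((hdvd 2).1 (by rw [map_ofNat]; exact h))
  have hx : Ideal.Quotient.mk (Ideal.span {p}) a ^ 2 - 4 =
      Ideal.Quotient.mk (Ideal.span {p}) (a ^ 2 - 4) := by
    simp only [map_sub, map_pow, map_ofNat]
  rw [rhoG, natCard_quadratic_eq h2', natCard_sq_eq h2', hx, legG]
  have hsq : (∃ y, y ^ 2 = Ideal.Quotient.mk (Ideal.span {p}) (a ^ 2 - 4)) ↔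
      ∃ y : GaussianInt, p ∣ y ^ 2 - (a ^ 2 - 4) := by
    rw [Ideal.Quotient.mk_surjective.exists]
    refine exists_congr fun y => ?_
    rw [← hdvd, map_sub _ (y ^ 2), map_pow, sub_eq_zero]
  simp only [hdvd, hsq]

theorem isCoprime_two_of_odd_Gnorm {k : GaussianInt} (h : Odd (Gnorm k)) : IsCoprime k 2 := by
  have h' : Odd (Zsqrtd.norm k) := Int.natAbs_odd.1 h
  obtain ⟨n, hn⟩ := h'
  refine ⟨star k, -(n : GaussianInt), ?_⟩
  have := Zsqrtd.norm_eq_mul_conj k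
  rw [hn] at this
  push_cast at this
  linear_combination -this

theorem rhoG_eq_finsum_quadSym {k : GaussianInt} (h0 : k ≠ 0) (hk : Squarefree k)
    (h2 : IsCoprime k 2) (a : GaussianInt) :
    (rhoG k a : ℤ) =
      ∑ᶠ I ∈ {I : Ideal GaussianInt | I ∣ Ideal.span {k}}, quadSym (genG I) (a ^ 2 - 4) := by
  induction k using UniqueFactorizationMonoid.induction_on_prime with
  | h₁ => exact absurd rfl h0
  | h₂ u hu =>
    have htop : Ideal.span {u} = ⊤ := Ideal.span_singleton_eq_top.2 hu
    have hset : {I : Ideal GaussianInt | I ∣ Ideal.span {u}} = {Ideal.span {u}} := by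
      ext I
      simp [htop, ← Ideal.one_eq_top, ← isUnit_iff_dvd_one]
    rw [hset, finsum_mem_singleton, quadSym_congr (associated_genG_span u),
      quadSym_of_isUnit hu, rhoG_of_isUnit hu, Nat.cast_one]
  | h₃ m p hm hp ih =>
    have hpm : ¬ p ∣ m := fun h => hp.not_isUnit (hk p (mul_dvd_mul_left p h))
    have hp2 : ¬ p ∣ 2 := fun h => hp.not_isUnit (h2.of_mul_left_left.isUnit_of_dvd' dvd_rfl h)
    rw [rhoG_mul ((hp.irreducible.coprime_iff_not_dvd).2 hpm), Nat.cast_mul,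
      rhoG_of_prime hp hp2, ih hm (hk.squarefree_of_dvd (dvd_mul_left m p)) h2.of_mul_left_right,
      finsum_quadSym_prime_mul hp hm hpm]

theorem stmt9 : ∀ k : GaussianInt, k ≠ 0 → Squarefree k → Odd (Gnorm k) →
    ∀ a : GaussianInt,
    (rhoG k a : ℤ) =
      ∑ᶠ I ∈ {I : Ideal GaussianInt | I ∣ Ideal.span ({k} : Set GaussianInt)},
        quadSym (genG I) (a ^ 2 - 4) := by
  intro k h0 hk hodd a
  exact rhoG_eq_finsum_quadSym h0 hk (isCoprime_two_of_odd_Gnorm hodd) a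

end PGT
end
end

section
/- For every ε > 0 there exists a constant C > 0 such that for every nonzero c ∈ ℤ[i] and every δ ∈ ℤ[i], ρ_c(δ) ≤ C·N(c)^ε·N(c_⋆). -/
noncomputable section

namespace PGT

theorem Gnorm_mul (a b : GaussianInt) : Gnorm (a * b) = Gnorm a * Gnorm b := by
  simp [Gnorm, Zsqrtd.norm_mul, Int.natAbs_mul]

theorem Gnorm_pos {a : GaussianInt} (ha : a ≠ 0) : 0 < Gnorm a :=
  Int.natAbs_pos.2 (GaussianInt.norm_pos.2 ha).ne'

theorem Gnorm_le_of_dvd {a b : GaussianInt} (hb : b ≠ 0) (h : a ∣ b) : Gnorm a ≤ Gnorm b := by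
  obtain ⟨k, rfl⟩ := h
  rw [Gnorm_mul]
  exact Nat.le_mul_of_pos_right _ (Gnorm_pos (right_ne_zero_of_mul hb))

theorem Gnorm_eq_one_iff {a : GaussianInt} : Gnorm a = 1 ↔ IsUnit a :=
  Zsqrtd.norm_eq_one_iff

theorem exists_finset_Gnorm_le (n : ℕ) :
    ∃ F : Finset GaussianInt, F.card ≤ (2 * n.sqrt + 1) ^ 2 ∧ ∀ x, Gnorm x ≤ n → x ∈ F := by
  let I : Finset ℤ := Finset.Icc (-(n.sqrt : ℤ)) n.sqrt
  have hI : I.card = 2 * n.sqrt + 1 := by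
    simp only [I, Int.card_Icc]
    omega
  refine ⟨(I ×ˢ I).image fun p => ⟨p.1, p.2⟩, ?_, fun x hx => ?_⟩
  · refine Finset.card_image_le.trans ?_
    rw [Finset.card_product, hI, sq]
  · rw [Gnorm, GaussianInt.natAbs_norm_eq] at hx
    have hre : x.re.natAbs ≤ n.sqrt := Nat.le_sqrt.2 (by omega)
    have him : x.im.natAbs ≤ n.sqrt := Nat.le_sqrt.2 (by omega)
    refine Finset.mem_image.2 ⟨(x.re, x.im), ?_, rfl⟩
    simp only [I, Finset.mem_product, Finset.mem_Icc]
    omega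

theorem exists_finset_Gnorm_le_card_le {n : ℕ} (hn : 0 < n) :
    ∃ F : Finset GaussianInt, F.card ≤ 9 * n ∧ ∀ x, Gnorm x ≤ n → x ∈ F := by
  obtain ⟨F, hF, hmem⟩ := exists_finset_Gnorm_le n
  refine ⟨F, hF.trans ?_, hmem⟩
  have h1 : 1 ≤ n.sqrt := Nat.sqrt_pos.2 hn
  have h2 : n.sqrt * n.sqrt ≤ n := Nat.sqrt_le n
  nlinarith

theorem card_le_of_dvd_sub_of_dvd_add {c t e y₀ : GaussianInt} (hc : c ≠ 0) (hte : t * e = 4 * c)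
    (S : Finset GaussianInt) (hS : ∀ y ∈ S, t ∣ y - y₀ ∧ e ∣ y + y₀)
    (hinj : ∀ y ∈ S, ∀ z ∈ S, 2 * c ∣ y - z → y = z) :
    S.card ≤ 9 * Gnorm (EuclideanDomain.gcd t e) := by
  have h4c : (4 : GaussianInt) * c ≠ 0 := mul_ne_zero (by decide) hc
  set g := EuclideanDomain.gcd t e with hg
  set l := EuclideanDomain.lcm t e with hl
  have hgl : g * l = 4 * c := (EuclideanDomain.gcd_mul_lcm t e).trans hte
  have hg0 : g ≠ 0 := left_ne_zero_of_mul (hgl ▸ h4c)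
  have hl0 : l ≠ 0 := right_ne_zero_of_mul (hgl ▸ h4c)
  obtain rfl | ⟨y₁, hy₁⟩ := S.eq_empty_or_nonempty
  · simp
  have hdvd : ∀ y ∈ S, l ∣ y - y₁ := fun y hy =>
    EuclideanDomain.lcm_dvd
      (by simpa using dvd_sub (hS y hy).1 (hS y₁ hy₁).1)
      (by simpa using dvd_sub (hS y hy).2 (hS y₁ hy₁).2)
  obtain ⟨F, hF, hmem⟩ := exists_finset_Gnorm_le_card_le (Gnorm_pos hg0)
  refine (Finset.card_le_card_of_injOn (fun y => (y - y₁) / l % g)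
    (fun y _ => hmem _ (GaussianInt.natAbs_norm_mod_lt _ hg0).le) ?_).trans hF
  intro y hy z hz hyz
  have hy' := EuclideanDomain.mul_div_cancel' hl0 (hdvd y hy)
  have hz' := EuclideanDomain.mul_div_cancel' hl0 (hdvd z hz)
  have h1 := EuclideanDomain.div_add_mod ((y - y₁) / l) g
  have h2 := EuclideanDomain.div_add_mod ((z - y₁) / l) g
  simp only at hyz
  refine hinj y hy z hz ⟨2 * ((y - y₁) / l / g - (z - y₁) / l / g), ?_⟩
  linear_combination -hy' + hz' - l * h1 + l * h2 + l * hyz +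
    ((y - y₁) / l / g - (z - y₁) / l / g) * hgl

theorem Gnorm_le_NStar {c d : GaussianInt} (hc : c ≠ 0) (h : d ^ 2 ∣ c) : Gnorm d ≤ NStar c := by
  refine le_csSup ⟨Gnorm c, ?_⟩ ⟨d, h, rfl⟩
  rintro m ⟨d, hd, rfl⟩
  exact Gnorm_le_of_dvd hc ((dvd_pow_self d two_ne_zero).trans hd)

theorem Gnorm_le_four_mul_NStar {c g : GaussianInt} (hc : c ≠ 0) (h : g ^ 2 ∣ 4 * c) :
    Gnorm g ≤ 4 * NStar c := by
  have h2 : (2 : GaussianInt) ≠ 0 := by decide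
  have hh0 : EuclideanDomain.gcd g 2 ≠ 0 := fun h0 => h2 (EuclideanDomain.gcd_eq_zero_iff.1 h0).2
  obtain ⟨a, ha⟩ := EuclideanDomain.gcd_dvd_left g 2
  obtain ⟨k, hk⟩ := EuclideanDomain.gcd_dvd_right g 2
  have hbez := EuclideanDomain.gcd_eq_gcd_ab g 2
  set h' := EuclideanDomain.gcd g 2
  have hcop : IsCoprime a k := by
    refine ⟨EuclideanDomain.gcdA g 2, EuclideanDomain.gcdB g 2, mul_left_cancel₀ hh0 ?_⟩
    linear_combination -hbez - EuclideanDomain.gcdA g 2 * ha - EuclideanDomain.gcdB g 2 * hk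
  have hac : a ^ 2 ∣ k ^ 2 * c := by
    refine (mul_dvd_mul_iff_left (pow_ne_zero 2 hh0)).1 ?_
    rw [← mul_pow, ← ha, ← mul_assoc, ← mul_pow, ← hk]
    convert h using 2
    norm_num
  have hdvd : a ^ 2 ∣ c := (hcop.pow (m := 2) (n := 2)).dvd_of_dvd_mul_left hac
  rw [ha, Gnorm_mul]
  exact Nat.mul_le_mul (Gnorm_le_of_dvd h2 ⟨k, hk⟩) (Gnorm_le_NStar hc hdvd)

theorem rhoc_le_card_mul_NStar {c : GaussianInt} (hc : c ≠ 0) (δ : GaussianInt)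
    (T : Finset GaussianInt) (hT : ∀ d, d ∣ 4 * c → ∃ t ∈ T, Associated t d) :
    rhoc c δ ≤ 36 * NStar c * T.card := by
  classical
  unfold rhoc
  set X := {x : GaussianInt ⧸ Ideal.span ({2 * c} : Set GaussianInt) //
    ∃ y : GaussianInt, Ideal.Quotient.mk (Ideal.span ({2 * c} : Set GaussianInt)) y = x ∧
      4 * c ∣ y ^ 2 - δ}
  cases finite_or_infinite X
  swap
  · simp
  have := Fintype.ofFinite X
  rw [Nat.card_eq_fintype_card]
  choose y hy hyδ using fun x : X => x.2
  rcases isEmpty_or_nonempty X with hX | ⟨⟨x₀⟩⟩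
  · simp
  have hfac : ∀ x, ∃ t ∈ T, ∃ e, t * e = 4 * c ∧ t ∣ y x - y x₀ ∧ e ∣ y x + y x₀ := by
    intro x
    have hdvd : 4 * c ∣ (y x - y x₀) * (y x + y x₀) := by
      convert dvd_sub (hyδ x) (hyδ x₀) using 1
      ring
    obtain ⟨d, e, hd, he, hde⟩ := exists_dvd_and_dvd_of_dvd_mul hdvd
    obtain ⟨t, ht, u, rfl⟩ := hT d ⟨e, hde⟩
    refine ⟨t, ht, u * e, by rw [hde, mul_assoc], (Dvd.intro _ rfl).trans hd, ?_⟩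
    exact (Units.mul_left_dvd).2 he
  choose t ht e hte htd hed using hfac
  rw [← Finset.card_univ]
  refine Finset.card_le_mul_card_image_of_maps_to (f := t) (t := T) (fun x _ => ht x) _ ?_
  intro τ _
  obtain h0 | ⟨x₁, hx₁⟩ := ({x ∈ (Finset.univ : Finset X) | t x = τ}).eq_empty_or_nonempty
  · simp [h0]
  have hyinj : ∀ x x', 2 * c ∣ y x - y x' → x = x' := by
    intro x x' h
    apply Subtype.ext
    rw [← hy x, ← hy x']
    exact Ideal.Quotient.eq.2 (Ideal.mem_span_singleton.2 h)
  have ht₁ : t x₁ = τ := (Finset.mem_filter.1 hx₁).2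
  have hτ : τ * e x₁ = 4 * c := ht₁ ▸ hte x₁
  have hτ0 : τ ≠ 0 := left_ne_zero_of_mul (hτ ▸ mul_ne_zero (by decide) hc)
  rw [← Finset.card_image_of_injective _
    (show Function.Injective y from fun a b hab => hyinj a b (by simp [hab]))]
  refine (card_le_of_dvd_sub_of_dvd_add (y₀ := y x₀) hc hτ _ ?_ ?_).trans ?_
  · intro z hz
    obtain ⟨x, hx, rfl⟩ := Finset.mem_image.1 hz
    have htx : t x = τ := (Finset.mem_filter.1 hx).2
    have hex : e x = e x₁ := mul_left_cancel₀ hτ0 (by rw [hτ, ← hte x, htx])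
    exact ⟨htx ▸ htd x, hex ▸ hed x⟩
  · intro z hz w hw hzw
    obtain ⟨x, -, rfl⟩ := Finset.mem_image.1 hz
    obtain ⟨x', -, rfl⟩ := Finset.mem_image.1 hw
    rw [hyinj x x' hzw]
  · have hg : EuclideanDomain.gcd τ (e x₁) ^ 2 ∣ 4 * c := by
      rw [← hτ, sq]
      exact mul_dvd_mul (EuclideanDomain.gcd_dvd_left _ _) (EuclideanDomain.gcd_dvd_right _ _)
    have := Gnorm_le_four_mul_NStar hc hg
    omega

theorem exists_add_one_le_mul_rpow {ε : ℝ} (hε : 0 < ε) :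
    ∃ K : ℝ, 1 ≤ K ∧ ∀ k : ℕ, (k : ℝ) + 1 ≤ K * (2 ^ ε) ^ k := by
  have ha : 0 < (2 : ℝ) ^ ε - 1 := sub_pos.2 (Real.one_lt_rpow one_lt_two hε)
  set a := (2 : ℝ) ^ ε - 1 with ha'
  refine ⟨1 + 1 / a, by simp [ha.le], fun k => ?_⟩
  have hB := one_add_mul_le_pow (a := a) (by linarith) k
  rw [show (2 : ℝ) ^ ε = 1 + a by ring]
  calc (k : ℝ) + 1 ≤ (1 + 1 / a) * (1 + k * a) := by
        have h1 : (1 + 1 / a) * (1 + k * a) = 1 + k + k * a + 1 / a := by field_simp; ring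
        have : 0 ≤ k * a := by positivity
        have : 0 ≤ 1 / a := by positivity
        linarith
    _ ≤ _ := by gcongr

theorem exists_finset_divisors_prime_pow {p : GaussianInt} (hp : Prime p) (k : ℕ) :
    ∃ T : Finset GaussianInt, T.card ≤ k + 1 ∧ ∀ d, d ∣ p ^ k → ∃ t ∈ T, Associated t d := by
  refine ⟨(Finset.range (k + 1)).image (p ^ ·), Finset.card_image_le.trans (by simp), ?_⟩
  intro d hd
  obtain ⟨i, hi, h⟩ := (dvd_prime_pow hp k).1 hd
  exact ⟨p ^ i, Finset.mem_image.2 ⟨i, by simpa [Nat.lt_succ_iff] using hi, rfl⟩, h.symm⟩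

theorem exists_divisor_bound {ε : ℝ} (hε : 0 < ε) :
    ∃ C : ℝ, 0 < C ∧ ∀ n : GaussianInt, n ≠ 0 → ∃ T : Finset GaussianInt,
      (T.card : ℝ) ≤ C * (Gnorm n : ℝ) ^ ε ∧ ∀ d, d ∣ n → ∃ t ∈ T, Associated t d := by
  classical
  obtain ⟨K, hK1, hK⟩ := exists_add_one_le_mul_rpow hε
  obtain ⟨S, -, hS⟩ := exists_finset_Gnorm_le ⌈(2 : ℝ) ^ (1 / ε)⌉₊
  let P (n : GaussianInt) : Finset GaussianInt := {p ∈ S | Prime p ∧ p ∣ n}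
  suffices H : ∀ n : GaussianInt, n ≠ 0 → ∃ T : Finset GaussianInt,
      (T.card : ℝ) ≤ K ^ (P n).card * (Gnorm n : ℝ) ^ ε ∧
        ∀ d, d ∣ n → ∃ t ∈ T, Associated t d by
    refine ⟨K ^ S.card, by positivity, fun n hn => ?_⟩
    obtain ⟨T, hT, h⟩ := H n hn
    refine ⟨T, hT.trans ?_, h⟩
    gcongr
    exact Finset.filter_subset _ _
  intro n
  refine UniqueFactorizationMonoid.induction_on_coprime n (fun h => (h rfl).elim) ?_ ?_ ?_
  · intro x hx _
    refine ⟨{1}, ?_, fun d hd => ⟨1, by simp, ?_⟩⟩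
    · rw [Gnorm_eq_one_iff.2 hx]
      simpa using one_le_pow₀ hK1
    · exact (associated_one_iff_isUnit.2 (isUnit_of_dvd_unit hd hx)).symm
  · intro p k hp _
    obtain ⟨T, hT, h⟩ := exists_finset_divisors_prime_pow hp k
    refine ⟨T, ?_, h⟩
    have hT' : (T.card : ℝ) ≤ k + 1 := mod_cast hT
    refine hT'.trans ?_
    obtain rfl | hk := Nat.eq_zero_or_pos k
    · simpa [Gnorm] using one_le_pow₀ hK1
    have hpow : (Gnorm (p ^ k) : ℝ) ^ ε = ((Gnorm p : ℝ) ^ ε) ^ k := by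
      have : Gnorm (p ^ k) = Gnorm p ^ k := by
        clear * -
        induction k with
        | zero => simp [Gnorm]
        | succ k ih => rw [pow_succ, Gnorm_mul, ih, pow_succ]
      rw [this, Nat.cast_pow, ← Real.rpow_natCast, ← Real.rpow_natCast, ← Real.rpow_mul (by simp),
        ← Real.rpow_mul (by simp), mul_comm]
    rw [hpow]
    by_cases hpS : p ∈ S
    · have hcard : 1 ≤ (P (p ^ k)).card :=
        Finset.card_pos.2 ⟨p, Finset.mem_filter.2 ⟨hpS, hp, dvd_pow_self p hk.ne'⟩⟩
      have h2 : 2 ≤ Gnorm p := by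
        have h0 := Gnorm_pos hp.ne_zero
        have h1 : Gnorm p ≠ 1 := fun h => hp.not_isUnit (Gnorm_eq_one_iff.1 h)
        omega
      have h2' : (2 : ℝ) ≤ Gnorm p := mod_cast h2
      refine (hK k).trans ?_
      gcongr
      exact le_self_pow₀ hK1 (by omega)
    · have hlt : (2 : ℝ) ^ (1 / ε) ≤ Gnorm p := by
        have : ⌈(2 : ℝ) ^ (1 / ε)⌉₊ ≤ Gnorm p := by
          by_contra! hlt
          exact hpS (hS p hlt.le)
        exact (Nat.le_ceil _).trans (mod_cast this)
      have h2 : (2 : ℝ) ≤ (Gnorm p : ℝ) ^ ε := by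
        have := Real.rpow_le_rpow (by positivity) hlt hε.le
        rwa [← Real.rpow_mul (by norm_num), one_div_mul_cancel hε.ne', Real.rpow_one] at this
      calc (k : ℝ) + 1 ≤ 2 ^ k := mod_cast Nat.lt_two_pow_self
        _ ≤ ((Gnorm p : ℝ) ^ ε) ^ k := by gcongr
        _ ≤ _ := le_mul_of_one_le_left (by positivity) (one_le_pow₀ hK1)
  · intro x y hxy hx hy h0
    obtain ⟨A, hA, hA'⟩ := hx (left_ne_zero_of_mul h0)
    obtain ⟨B, hB, hB'⟩ := hy (right_ne_zero_of_mul h0)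
    refine ⟨(A ×ˢ B).image fun q => q.1 * q.2, ?_, fun d hd => ?_⟩
    · have hdisj : Disjoint (P x) (P y) := Finset.disjoint_left.2 fun p hpx hpy =>
        (Finset.mem_filter.1 hpx).2.1.not_isUnit
          (hxy (Finset.mem_filter.1 hpx).2.2 (Finset.mem_filter.1 hpy).2.2)
      have hsub : P x ∪ P y ⊆ P (x * y) := by
        intro p hp
        rcases Finset.mem_union.1 hp with hp | hp <;>
          obtain ⟨h1, h2, h3⟩ := Finset.mem_filter.1 hp
        · exact Finset.mem_filter.2 ⟨h1, h2, h3.mul_right y⟩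
        · exact Finset.mem_filter.2 ⟨h1, h2, h3.mul_left x⟩
      have hcard : (P x).card + (P y).card ≤ (P (x * y)).card :=
        Finset.card_union_of_disjoint hdisj ▸ Finset.card_le_card hsub
      calc ((((A ×ˢ B).image fun q => q.1 * q.2).card : ℕ) : ℝ) ≤ A.card * B.card := by
            exact_mod_cast Finset.card_image_le.trans (Finset.card_product A B).le
        _ ≤ (K ^ (P x).card * (Gnorm x : ℝ) ^ ε) * (K ^ (P y).card * (Gnorm y : ℝ) ^ ε) := by
            gcongr
        _ = K ^ ((P x).card + (P y).card) * (Gnorm (x * y) : ℝ) ^ ε := by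
            rw [Gnorm_mul, Nat.cast_mul, Real.mul_rpow (by simp) (by simp), pow_add]
            ring
        _ ≤ _ := by gcongr
    · obtain ⟨a, b, ha, hb, rfl⟩ := exists_dvd_and_dvd_of_dvd_mul hd
      obtain ⟨s, hs, hsa⟩ := hA' a ha
      obtain ⟨t, ht, htb⟩ := hB' b hb
      exact ⟨s * t, Finset.mem_image.2 ⟨(s, t), Finset.mem_product.2 ⟨hs, ht⟩, rfl⟩,
        hsa.mul_mul htb⟩

theorem stmt10 : ∀ ε : ℝ, 0 < ε → ∃ C : ℝ, 0 < C ∧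
    ∀ c : GaussianInt, c ≠ 0 → ∀ δ : GaussianInt,
    (rhoc c δ : ℝ) ≤ C * (Gnorm c : ℝ) ^ ε * (NStar c : ℝ) := by
  intro ε hε
  obtain ⟨C, hC, hdiv⟩ := exists_divisor_bound hε
  refine ⟨36 * C * 16 ^ ε, by positivity, fun c hc δ => ?_⟩
  obtain ⟨T, hT, hT'⟩ := hdiv (4 * c) (mul_ne_zero (by decide) hc)
  have h4 : Gnorm 4 = 16 := by decide
  rw [Gnorm_mul, h4, Nat.cast_mul, Real.mul_rpow (by simp) (by simp)] at hT
  push_cast at hT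
  calc (rhoc c δ : ℝ) ≤ 36 * NStar c * T.card := mod_cast rhoc_le_card_mul_NStar hc δ T hT'
    _ ≤ 36 * NStar c * (C * (16 ^ ε * (Gnorm c : ℝ) ^ ε)) := by gcongr
    _ = _ := by ring

end PGT
end
end
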